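/- Let w be a log-convex weight function on [0,1) and d ≥ 2. Then there exists a real-valued harmonic function f on the unit ball B_d ⊂ ℝ^d such that M₂(f, r) ≍ w(r) for 0 ≤ r < 1. -/

import Mathlib

open MeasureTheory Set Metric

noncomputable section

/-- The open unit ball of `ℝ^d` (as `EuclideanSpace`). -/
def unitBall (d : ℕ) : Set (EuclideanSpace ℝ (Fin d)) := Metric.ball 0 1

/-- `f` is harmonic on `s ⊆ ℝ^d`: it is `C²` on a neighborhood-like set and its
Laplacian (sum of second derivatives in the coordinate directions) vanishes on `s`. -/
def IsHarmonicOn {d : ℕ} (f : EuclideanSpace ℝ (Fin d) → ℝ)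
    (s : Set (EuclideanSpace ℝ (Fin d))) : Prop :=
  ContDiffOn ℝ 2 f s ∧ ∀ x ∈ s,
    ∑ i : Fin d, fderiv ℝ (fun y => fderiv ℝ f y (EuclideanSpace.single i 1)) x
      (EuclideanSpace.single i 1) = 0

/-- A weight function: positive, non-decreasing, continuous and unbounded on `[0,1)`. -/
def IsWeight (w : ℝ → ℝ) : Prop :=
  ContinuousOn w (Set.Ico 0 1) ∧ MonotoneOn w (Set.Ico 0 1) ∧
    (∀ r ∈ Set.Ico (0:ℝ) 1, 0 < w r) ∧
    ∀ M : ℝ, ∃ r ∈ Set.Ico (0:ℝ) 1, M < w r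

/-- `w` is log-convex: `log (w r)` is a convex function of `log r` on `(0,1)`. -/
def IsLogConvex (w : ℝ → ℝ) : Prop :=
  ConvexOn ℝ (Set.Iio (0:ℝ)) (fun t => Real.log (w (Real.exp t)))

/-- Two functions are equivalent on `[0,1)`. -/
def EquivOn01 (w v : ℝ → ℝ) : Prop :=
  ∃ c₁ c₂ : ℝ, 0 < c₁ ∧ 0 < c₂ ∧
    ∀ r ∈ Set.Ico (0:ℝ) 1, c₁ * v r ≤ w r ∧ w r ≤ c₂ * v r

/-- The normalized surface measure on the unit sphere of `ℝ^d`. -/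
def sphereMeasure (d : ℕ) : Measure (Metric.sphere (0 : EuclideanSpace ℝ (Fin d)) 1) :=
  ((volume : Measure (EuclideanSpace ℝ (Fin d))).toSphere Set.univ)⁻¹ •
    (volume : Measure (EuclideanSpace ℝ (Fin d))).toSphere

/-- The squared `L²`-mean of `f` on the sphere of radius `r`. -/
def M2sq {d : ℕ} (f : EuclideanSpace ℝ (Fin d) → ℝ) (r : ℝ) : ℝ :=
  ∫ y : Metric.sphere (0 : EuclideanSpace ℝ (Fin d)) 1,
    (f (r • (y : EuclideanSpace ℝ (Fin d))))^2 ∂(sphereMeasure d)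


theorem h5_affine {g : ℝ → ℝ} (hc : ConvexOn ℝ (Iio (0:ℝ)) g) {a b t p q : ℝ}
    (hb : b < 0) (hat : a ≤ t) (htb : t ≤ b) (ha : g a ≤ p * a + q) (hgb : g b ≤ p * b + q) :
    g t ≤ p * t + q := by
  have h2 : ConvexOn ℝ (Iio (0:ℝ)) (fun x => g x + ((-p) * x + (-q))) := by
    refine hc.add ⟨convex_Iio 0, ?_⟩
    intro x _ y _ u v _ _ huv
    simp only [smul_eq_mul]
    have : v = 1 - u := by linarith
    subst this
    nlinarith
  have h3 := h2.le_max_of_mem_Icc (x := a) (y := b) (z := t)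
    (by simp only [mem_Iio]; linarith) (by simpa using hb) ⟨hat, htb⟩
  have h4 := h3.trans (max_le (c := 0) (by linarith) (by linarith))
  linarith

theorem h5_touch {g : ℝ → ℝ} (hcont : ContinuousOn g (Iio (0:ℝ))) {m : ℝ}
    (hmono : MonotoneOn g (Iio (0:ℝ)))
    (hm : ∀ t < 0, m ≤ g t) (hub : ∀ M, ∃ t < 0, M < g t) (p : ℝ) (hp : 1 ≤ p) :
    ∃ τ < 0, ∀ t < 0, g τ + p * (t - τ) ≤ g t := by
  set K := g (-1) + p with hK
  obtain ⟨b, hb, hKb⟩ := hub K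
  set a := min (-1) (m - K) with ha
  have hm1 := hm (-1) (by norm_num)
  have h1b : -1 ≤ b := by
    by_contra h
    push Not at h
    have := hmono (a := b) (b := -1) hb (by norm_num) h.le
    linarith
  have ha1 : a ≤ -1 := min_le_left _ _
  have ha2 : a ≤ m - K := min_le_right _ _
  obtain ⟨τ, hτ, hmin⟩ := (isCompact_Icc (a := a) (b := b)).exists_isMinOn
    ⟨-1, ha1, h1b⟩ (f := fun t => g t - p * t)
    ((hcont.mono (fun x hx => lt_of_le_of_lt hx.2 hb)).sub (by fun_prop))
  have hmin' : ∀ t ∈ Icc a b, g τ - p * τ ≤ g t - p * t := fun t ht => hmin ht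
  have hK2 : g τ - p * τ ≤ K := by
    have := hmin' (-1) ⟨ha1, h1b⟩
    linarith
  refine ⟨τ, lt_of_le_of_lt hτ.2 hb, fun t ht => ?_⟩
  have : g τ - p * τ ≤ g t - p * t := by
    by_cases h1 : t < a
    · have := hm t ht
      nlinarith
    by_cases h2 : b < t
    · have := hmono (a := b) (b := t) hb ht h2.le
      nlinarith
    push Not at h1 h2
    exact hmin' t ⟨h1, h2⟩
  linarith

theorem h5_select {g : ℝ → ℝ} (hc : ConvexOn ℝ (Iio (0:ℝ)) g)
    (hcont : ContinuousOn g (Iio (0:ℝ))) {m : ℝ}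
    (hmono : MonotoneOn g (Iio (0:ℝ)))
    (hm : ∀ t < 0, m ≤ g t) (hub : ∀ M, ∃ t < 0, M < g t) :
    ∃ (n : ℕ → ℕ) (β : ℕ → ℝ) (T C : ℝ), StrictMono n ∧ 1 ≤ n 0 ∧ T < 0 ∧
      (∀ t < 0, ∃ J : ℕ, ∀ i : ℕ, (i < J → (n i) * t + β i ≤ g t - ((J:ℝ) - 1 - i)) ∧
        (J ≤ i → (n i) * t + β i ≤ g t - ((i:ℝ) - J))) ∧
      (∀ t < 0, T ≤ t → ∃ i, g t ≤ (n i) * t + β i + C) := by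
  have htouch : ∀ k : ℕ, ∃ τ < 0, ∀ t < 0, g τ + ((k:ℝ)+1) * (t - τ) ≤ g t := fun k =>
    h5_touch hcont hmono hm hub _ (by have := Nat.cast_nonneg (α := ℝ) k; linarith)
  choose τ hτ0 hτ using htouch
  -- monotonicity of τ
  have hτm : Monotone τ := by
    refine monotone_nat_of_le_succ fun k => ?_
    have h1 := hτ k _ (hτ0 (k+1))
    have h2 := hτ (k+1) _ (hτ0 k)
    push_cast at h2
    nlinarith
  -- the lines
  set ℓ : ℕ → ℝ → ℝ := fun k t => g (τ k) + ((k:ℝ)+1) * (t - τ k) with hℓ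
  have hle : ∀ k, ∀ t < 0, ℓ k t ≤ g t := hτ
  have hself : ∀ k, ℓ k (τ k) = g (τ k) := fun k => by simp [hℓ]
  have hdiff : ∀ k s t, ℓ k t = ℓ k s + ((k:ℝ)+1) * (t - s) := fun k s t => by
    simp only [hℓ]; ring
  set D := - τ 0 with hD
  have hD0 : 0 < D := by have := hτ0 0; linarith
  have hτD : ∀ k, -D ≤ τ k := fun k => by have := hτm (Nat.zero_le k); linarith
  set A := D + 1 with hA
  -- separation
  let Sep : ℕ → ℕ → Prop := fun k l => ℓ l (τ k) ≤ g (τ k) - A ∧ ℓ k (τ l) ≤ g (τ l) - A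
  have hlim : ∀ s < 0, ∃ k0 : ℕ, ∀ k, k0 ≤ k → s ≤ τ k := by
    intro s hs
    obtain ⟨k0, hk0⟩ := exists_nat_gt ((g (s/2) - m) / (-s/2))
    refine ⟨k0, fun k hk => ?_⟩
    by_contra h
    push Not at h
    have h1 := hτ k (s/2) (by linarith)
    have h2 := hm _ (hτ0 k)
    rw [div_lt_iff₀ (by linarith)] at hk0
    have hk' : (k0:ℝ) ≤ k := by exact_mod_cast hk
    have h3 : ((k:ℝ)+1) * (-s/2) ≤ ((k:ℝ)+1) * (s/2 - τ k) := by
      apply mul_le_mul_of_nonneg_left _ (by positivity)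
      linarith
    nlinarith
  have hex : ∀ k, ∃ l, k < l ∧ Sep k l := by
    intro k
    obtain ⟨t1, ht1, hgt⟩ := hub (ℓ k 0 + A)
    have hkt1 : τ k < t1 := by
      by_contra h
      push Not at h
      have h1 := hmono (a := t1) (b := τ k) ht1 (hτ0 k) h
      have h2 := hdiff k (τ k) 0
      rw [hself] at h2
      have : 0 ≤ ((k:ℝ)+1) * (0 - τ k) := mul_nonneg (by positivity) (by linarith [hτ0 k])
      linarith
    obtain ⟨k0, hk0⟩ := hlim t1 ht1
    obtain ⟨k1, hk1⟩ := exists_nat_gt ((g t1 - g (τ k) + A) / (t1 - τ k))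
    refine ⟨max (k+1) (max k0 k1), by omega, ?_, ?_⟩
    · set l := max (k+1) (max k0 k1) with hl
      have h1 := hle l t1 ht1
      have h2 := hdiff l t1 (τ k)
      have h3 : (k1:ℝ) ≤ l := by exact_mod_cast (by omega)
      rw [div_lt_iff₀ (by linarith)] at hk1
      nlinarith
    · set l := max (k+1) (max k0 k1) with hl
      have h1 := hmono (a := t1) (b := τ l) ht1 (hτ0 l) (hk0 l (by omega))
      have h2 := hdiff k (τ l) 0
      have : 0 ≤ ((k:ℝ)+1) * (0 - τ l) := mul_nonneg (by positivity) (by linarith [hτ0 l])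
      linarith
  classical
  let nx : ℕ → ℕ := fun k => Nat.find (hex k)
  have hnx : ∀ k, k < nx k ∧ Sep k (nx k) := fun k => Nat.find_spec (hex k)
  have hcover : ∀ k t, τ k ≤ t → t ≤ τ (nx k) → g t ≤ max (ℓ k t) (ℓ (nx k) t) + (A + D) := by
    intro k t hkt htl
    obtain ⟨q, hq⟩ : ∃ q, nx k = q + 1 := ⟨nx k - 1, by have := (hnx k).1; omega⟩
    have hkq : k ≤ q := by have := (hnx k).1; omega
    have hnot : k < q → ¬ Sep k q := fun h hs => by
      have := Nat.find_min (hex k) (m := q) (by change q < nx k; omega)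
      exact this ⟨h, hs⟩
    rw [hq] at htl ⊢
    have ht0 : t < 0 := lt_of_le_of_lt htl (hτ0 _)
    -- ℓ q ≤ ℓ (q+1) + D
    have hrep : ℓ q t ≤ ℓ (q+1) t + D := by
      have h1 := hle q _ (hτ0 (q+1))
      rw [← hself (q+1)] at h1
      have h2 := hdiff q (τ (q+1)) t
      have h3 := hdiff (q+1) (τ (q+1)) t
      push_cast at h3
      have h4 := hτD k
      have h5 := hτ0 (q+1)
      nlinarith
    rcases le_total (τ q) t with h | h
    · -- between q and q+1
      have h1 : g t ≤ ((q:ℝ)+1) * t + (g (τ q) - ((q:ℝ)+1) * τ q + D) := by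
        refine h5_affine hc (hτ0 (q+1)) h htl (by linarith) ?_
        have h2 := hle (q+1) _ (hτ0 q)
        simp only [hℓ] at h2
        push_cast at h2
        have h4 := hτD q
        have h5 := hτ0 (q+1)
        nlinarith
      have h2 : ℓ q t = ((q:ℝ)+1) * t + (g (τ q) - ((q:ℝ)+1) * τ q) := by
        simp only [hℓ]; ring
      have := le_max_right (ℓ k t) (ℓ (q+1) t)
      linarith
    · rcases hkq.eq_or_lt with h' | h'
      · subst h'
        have : t = τ k := le_antisymm h hkt
        have h1 := hself k
        rw [← this] at h1
        have := le_max_left (ℓ k t) (ℓ (k+1) t)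
        linarith
      have hns := hnot h'
      simp only [Sep, not_and_or, not_le] at hns
      rcases hns with h1 | h1
      · have h2 : g t ≤ ((q:ℝ)+1) * t + (g (τ q) - ((q:ℝ)+1) * τ q + A) := by
          refine h5_affine hc (hτ0 q) hkt h ?_ (by linarith)
          simp only [hℓ] at h1
          linarith
        have h2 : ℓ q t = ((q:ℝ)+1) * t + (g (τ q) - ((q:ℝ)+1) * τ q) := by
          simp only [hℓ]; ring
        have := le_max_right (ℓ k t) (ℓ (q+1) t)
        linarith
      · have h2 : g t ≤ ((k:ℝ)+1) * t + (g (τ k) - ((k:ℝ)+1) * τ k + A) := by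
          refine h5_affine hc (hτ0 q) hkt h (by linarith) ?_
          simp only [hℓ] at h1
          linarith
        have h2 : ℓ k t = ((k:ℝ)+1) * t + (g (τ k) - ((k:ℝ)+1) * τ k) := by
          simp only [hℓ]; ring
        have := le_max_left (ℓ k t) (ℓ (q+1) t)
        linarith
  let n : ℕ → ℕ := fun j => nx^[j] 0
  have hns : ∀ j, n (j+1) = nx (n j) := fun j => Function.iterate_succ_apply' _ _ _
  have hnm : StrictMono n := strictMono_nat_of_lt_succ fun j => by
    rw [hns]; exact (hnx _).1
  have hn0 : n 0 = 0 := rfl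
  have hstepR : ∀ j, ∀ t ≤ τ (n j), ℓ (n (j+1)) t ≤ ℓ (n j) t - 1 := by
    intro j t ht
    have h1 := ((hnx (n j)).2).1
    rw [← hns] at h1
    have h2 := hdiff (n (j+1)) (τ (n j)) t
    have h3 := hdiff (n j) (τ (n j)) t
    rw [hself] at h3
    have h4 : ((n j : ℕ):ℝ) ≤ n (j+1) := by exact_mod_cast (hnm (Nat.lt_succ_self j)).le
    nlinarith
  have hstepL : ∀ j, ∀ t, τ (n (j+1)) ≤ t → ℓ (n j) t ≤ ℓ (n (j+1)) t - 1 := by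
    intro j t ht
    have h1 := ((hnx (n j)).2).2
    rw [← hns] at h1
    have h2 := hdiff (n (j+1)) (τ (n (j+1))) t
    have h3 := hdiff (n j) (τ (n (j+1))) t
    rw [hself] at h2
    have h4 : ((n j : ℕ):ℝ) ≤ n (j+1) := by exact_mod_cast (hnm (Nat.lt_succ_self j)).le
    nlinarith
  have hR : ∀ J i, ∀ t ≤ τ (n J), ℓ (n (J+i)) t ≤ ℓ (n J) t - i := by
    intro J i t ht
    induction i with
    | zero => simp
    | succ i ih =>
      have := hstepR (J+i) t (ht.trans (hτm (hnm.monotone (by omega))))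
      push_cast
      rw [← add_assoc]
      linarith
  have hL : ∀ J i, ∀ t, τ (n (J+i)) ≤ t → ℓ (n J) t ≤ ℓ (n (J+i)) t - i := by
    intro J i t ht
    induction i with
    | zero => simp
    | succ i ih =>
      have h1 := hstepL (J+i) t ht
      have h2 := ih ((hτm (hnm.monotone (by omega))).trans ht)
      push_cast
      rw [← add_assoc]
      linarith
  have hexJ : ∀ t < 0, ∃ i, t < τ (n i) := by
    intro t ht
    obtain ⟨k0, hk0⟩ := hlim (t/2) (by linarith)
    exact ⟨k0, by have := hk0 (n k0) (hnm.id_le k0); linarith⟩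
  refine ⟨fun j => n j + 1, fun j => g (τ (n j)) - ((n j : ℝ)+1) * τ (n j), τ 0, A + D,
    fun i j h => by simpa using hnm h, by simp, hτ0 0, ?_, ?_⟩
  · intro t ht
    have hev : ∀ j, ((n j + 1 : ℕ):ℝ) * t + (g (τ (n j)) - ((n j : ℝ)+1) * τ (n j)) = ℓ (n j) t := by
      intro j; simp only [hℓ]; push_cast; ring
    refine ⟨Nat.find (hexJ t ht), fun i => ⟨fun hi => ?_, fun hi => ?_⟩⟩
    · rw [hev]
      obtain ⟨J, hJ⟩ : ∃ J, Nat.find (hexJ t ht) = J + 1 :=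
        ⟨Nat.find (hexJ t ht) - 1, by omega⟩
      have h1 := Nat.find_min (hexJ t ht) (m := J) (by omega)
      push Not at h1
      obtain ⟨e, he⟩ := Nat.exists_eq_add_of_le (show i ≤ J by omega)
      rw [hJ, he]
      rw [he] at h1
      have h2 := hL i e t h1
      have h3 := hle (n (i+e)) t ht
      push_cast
      linarith
    · rw [hev]
      have h1 := Nat.find_spec (hexJ t ht)
      obtain ⟨e, he⟩ := Nat.exists_eq_add_of_le hi
      have h2 := hR _ e t h1.le
      have h3 := hle (n (Nat.find (hexJ t ht))) t ht
      rw [← he] at h2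
      have h4 : (i:ℝ) = (Nat.find (hexJ t ht) : ℕ) + (e:ℝ) := by exact_mod_cast he
      linarith
  · intro t ht hT
    have hev : ∀ j, ((n j + 1 : ℕ):ℝ) * t + (g (τ (n j)) - ((n j : ℝ)+1) * τ (n j)) = ℓ (n j) t := by
      intro j; simp only [hℓ]; push_cast; ring
    have h1 := Nat.find_spec (hexJ t ht)
    have hpos : Nat.find (hexJ t ht) ≠ 0 := by
      intro h
      rw [h, hn0] at h1
      linarith
    obtain ⟨J, hJ⟩ := Nat.exists_eq_succ_of_ne_zero hpos
    have h2 := Nat.find_min (hexJ t ht) (m := J) (by omega)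
    push Not at h2
    rw [hJ, Nat.succ_eq_add_one, hns] at h1
    have h3 := hcover (n J) t h2 h1.le
    rw [← hns] at h3
    rcases le_total (ℓ (n J) t) (ℓ (n (J+1)) t) with h | h
    · rw [max_eq_right h] at h3
      exact ⟨J+1, by rw [hev]; exact h3⟩
    · rw [max_eq_left h] at h3
      exact ⟨J, by rw [hev]; exact h3⟩

theorem h5_sum {x : ℕ → ℝ} {W : ℝ} {J : ℕ} (hx : ∀ i, 0 ≤ x i)
    (h1 : ∀ i, i < J → x i ≤ W * (1/2:ℝ)^(J-1-i)) (h2 : ∀ i, x (i + J) ≤ W * (1/2:ℝ)^i) :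
    Summable x ∧ ∑' i, x i ≤ 4 * W := by
  have hgs : Summable (fun i : ℕ => W * (1/2:ℝ)^i) := summable_geometric_two.mul_left W
  have hs2 : Summable (fun i => x (i + J)) :=
    Summable.of_nonneg_of_le (fun i => hx _) h2 hgs
  have hs : Summable x := (summable_nat_add_iff J).1 hs2
  have hW : 0 ≤ W := by have := (hx _).trans (h2 0); simpa using this
  refine ⟨hs, ?_⟩
  rw [← hs.sum_add_tsum_nat_add J]
  have h3 : ∑' i, x (i + J) ≤ W * 2 := by
    rw [← tsum_geometric_two, ← tsum_mul_left]
    exact hs2.tsum_le_tsum h2 hgs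
  have h4 : ∑ i ∈ Finset.range J, x i ≤ W * 2 := by
    calc ∑ i ∈ Finset.range J, x i ≤ ∑ i ∈ Finset.range J, W * (1/2:ℝ)^(J-1-i) :=
          Finset.sum_le_sum fun i hi => h1 i (Finset.mem_range.1 hi)
      _ = ∑ i ∈ Finset.range J, W * (1/2:ℝ)^i :=
          Finset.sum_range_reflect (fun i => W * (1/2:ℝ)^i) J
      _ ≤ ∑' i : ℕ, W * (1/2:ℝ)^i := hgs.sum_le_tsum _ (fun i _ => by positivity)
      _ = W * 2 := by rw [tsum_mul_left, tsum_geometric_two]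
  linarith

theorem h5_exp_le {u v : ℝ} {k : ℕ} (h : u ≤ v - k) : Real.exp u ≤ Real.exp v * (1/2:ℝ)^k := by
  have h1 : Real.exp (-1) ≤ 1/2 := by
    rw [Real.exp_neg, one_div]
    apply inv_anti₀ (by norm_num)
    have := Real.add_one_le_exp (1:ℝ)
    linarith
  calc Real.exp u ≤ Real.exp (v + k * (-1)) := Real.exp_le_exp.2 (by linarith)
    _ = Real.exp v * (Real.exp (-1))^k := by rw [Real.exp_add, Real.exp_nat_mul]
    _ ≤ _ := by gcongr

theorem h5_coef (w : ℝ → ℝ) (hw : IsWeight w) (hlc : IsLogConvex w) :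
    ∃ (N : ℕ → ℕ) (b : ℕ → ℝ) (c₁ c₂ : ℝ), Function.Injective N ∧ (∀ j, 0 ≤ b j) ∧
      0 < c₁ ∧ 0 < c₂ ∧ ∀ r ∈ Ico (0:ℝ) 1, Summable (fun j => b j * r ^ N j) ∧
        c₁ * w r ^ 2 ≤ ∑' j, (b j * r ^ N j)^2 ∧ ∑' j, (b j * r ^ N j)^2 ≤ c₂ * w r ^ 2 := by
  obtain ⟨hwc, hwm, hwp, hwu⟩ := hw
  have hz : (0:ℝ) ∈ Ico (0:ℝ) 1 := by simp
  have hexp : ∀ t < 0, Real.exp t ∈ Ico (0:ℝ) 1 := fun t ht =>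
    ⟨(Real.exp_pos t).le, by simpa using ht⟩
  have hw0 := hwp 0 hz
  obtain ⟨n, β, T, C, hn, hn0, hT, hup, hlow⟩ := h5_select (g := fun t => Real.log (w (Real.exp t)))
    (m := Real.log (w 0)) hlc
    (by
      refine ContinuousOn.log ?_ (fun t ht => (hwp _ (hexp t ht)).ne')
      exact hwc.comp Real.continuous_exp.continuousOn (fun t ht => hexp t ht))
    (fun s hs t ht hst => Real.log_le_log (hwp _ (hexp s hs))
      (hwm (hexp s hs) (hexp t ht) (Real.exp_le_exp.2 hst)))
    (fun t ht => Real.log_le_log hw0 (hwm hz (hexp t ht) (Real.exp_pos t).le))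
    (by
      intro M
      obtain ⟨r, hr, hrw⟩ := hwu (max (w 0) (Real.exp M))
      have hr0 : r ≠ 0 := by
        rintro rfl
        exact absurd (le_max_left (w 0) (Real.exp M)) (not_le.2 hrw)
      have hr0 : 0 < r := lt_of_le_of_ne hr.1 (Ne.symm hr0)
      refine ⟨Real.log r, Real.log_neg hr0 hr.2, ?_⟩
      simp only [Real.exp_log hr0]
      rw [Real.lt_log_iff_exp_lt (hwp r hr)]
      exact lt_of_le_of_lt (le_max_right _ _) hrw)
  let N : ℕ → ℕ := fun j => Nat.casesOn j 0 n
  let b : ℕ → ℝ := fun j => Nat.casesOn j (w 0) (fun i => Real.exp (β i))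
  have hN0 : N 0 = 0 := rfl
  have hNs : ∀ j, N (j+1) = n j := fun j => rfl
  have hb0 : b 0 = w 0 := rfl
  have hbs : ∀ j, b (j+1) = Real.exp (β j) := fun j => rfl
  have hnpos : ∀ j, 0 < n j := fun j => lt_of_lt_of_le hn0 (hn.monotone (Nat.zero_le j))
  have hwT := hwp _ (hexp T hT)
  refine ⟨N, b, min (w 0 ^ 2 / w (Real.exp T) ^ 2) (Real.exp (-(2 * C))), 5, ?_, ?_, ?_, by norm_num, ?_⟩
  · intro i j hij
    match i, j with
    | 0, 0 => rfl
    | 0, j+1 => have := hnpos j; rw [hN0, hNs] at hij; omega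
    | i+1, 0 => have := hnpos i; rw [hN0, hNs] at hij; omega
    | i+1, j+1 => rw [hNs, hNs] at hij; rw [hn.injective hij]
  · intro j
    match j with
    | 0 => exact hw0.le
    | j+1 => exact (Real.exp_pos _).le
  · exact lt_min (by positivity) (Real.exp_pos _)
  · intro r hr
    have hwr := hwp r hr
    have hw0r : w 0 ≤ w r := hwm hz hr hr.1
    -- summability of the shifted sequences
    have key : Summable (fun j => b (j+1) * r ^ N (j+1)) ∧
        Summable (fun j => (b (j+1) * r ^ N (j+1))^2) ∧
        ∑' j, (b (j+1) * r ^ N (j+1))^2 ≤ 4 * w r ^ 2 := by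
      rcases hr.1.eq_or_lt with h0 | h0
      · subst h0
        have : ∀ j, b (j+1) * (0:ℝ) ^ N (j+1) = 0 := fun j => by
          rw [hNs, zero_pow (hnpos j).ne', mul_zero]
        simp only [this]
        refine ⟨summable_zero, by simp, ?_⟩
        simp only [ne_eq, OfNat.ofNat_ne_zero, not_false_eq_true, zero_pow, tsum_zero]
        positivity
      · have ht : Real.log r < 0 := Real.log_neg h0 hr.2
        obtain ⟨J, hJ⟩ := hup (Real.log r) ht
        simp only [Real.exp_log h0] at hJ
        have hterm : ∀ j, b (j+1) * r ^ N (j+1) = Real.exp (n j * Real.log r + β j) := by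
          intro j
          rw [hbs, hNs, Real.exp_add, Real.exp_nat_mul, Real.exp_log h0, mul_comm]
        have e1 : ∀ i, i < J → b (i+1) * r ^ N (i+1) ≤ w r * (1/2:ℝ)^(J-1-i) := by
          intro i hi
          rw [hterm, ← Real.exp_log hwr]
          refine h5_exp_le ((hJ i).1 hi |>.trans ?_)
          have h : ((J - 1 - i : ℕ):ℝ) = (J:ℝ) - 1 - i := by
            rw [Nat.cast_sub (by omega), Nat.cast_sub (by omega)]; simp
          rw [h]
        have e2 : ∀ i, b (i+J+1) * r ^ N (i+J+1) ≤ w r * (1/2:ℝ)^i := by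
          intro i
          rw [hterm, ← Real.exp_log hwr]
          refine h5_exp_le ((hJ (i+J)).2 (by omega) |>.trans ?_)
          push_cast
          linarith
        have hpos : ∀ j, 0 ≤ b (j+1) * r ^ N (j+1) := fun j => by rw [hterm]; positivity
        have sqb : ∀ {u : ℝ} {k : ℕ}, 0 ≤ u → u ≤ w r * (1/2:ℝ)^k → u^2 ≤ w r ^ 2 * (1/2:ℝ)^k := by
          intro u k hu huk
          have h1 : (1/2:ℝ)^k ≤ 1 := pow_le_one₀ (by norm_num) (by norm_num)
          have h0 : 0 < (1/2:ℝ)^k := by positivity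
          calc u^2 ≤ (w r * (1/2:ℝ)^k)^2 := by gcongr
            _ = w r ^ 2 * ((1/2:ℝ)^k * (1/2:ℝ)^k) := by ring
            _ ≤ w r ^ 2 * ((1/2:ℝ)^k * 1) := by gcongr
            _ = _ := by ring
        have s1 := h5_sum (x := fun j => b (j+1) * r ^ N (j+1)) (J := J) hpos e1 e2
        have s2 := h5_sum (x := fun j => (b (j+1) * r ^ N (j+1))^2) (W := w r ^ 2) (J := J)
          (fun j => sq_nonneg _) (fun i hi => sqb (hpos _) (e1 i hi)) (fun i => sqb (hpos _) (e2 i))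
        exact ⟨s1.1, s2.1, s2.2⟩
    have hS2 : Summable (fun j => (b j * r ^ N j)^2) := (summable_nat_add_iff 1).1 key.2.1
    refine ⟨(summable_nat_add_iff 1).1 key.1, ?_, ?_⟩
    · rcases le_or_gt r (Real.exp T) with hrT | hrT
      · have h1 : (b 0 * r ^ N 0)^2 ≤ ∑' j, (b j * r ^ N j)^2 :=
          hS2.le_tsum 0 (fun j _ => sq_nonneg _)
        rw [hb0, hN0, pow_zero, mul_one] at h1
        refine le_trans ?_ h1
        have h2 : w r ≤ w (Real.exp T) := hwm hr (hexp T hT) hrT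
        calc _ ≤ w 0 ^ 2 / w (Real.exp T) ^ 2 * w (Real.exp T) ^ 2 := by
              gcongr
              exact min_le_left _ _
          _ = w 0 ^ 2 := by field_simp
      · have h0 : 0 < r := (Real.exp_pos T).trans hrT
        have ht : Real.log r < 0 := Real.log_neg h0 hr.2
        obtain ⟨i, hi⟩ := hlow (Real.log r) ht ((Real.le_log_iff_exp_le h0).2 hrT.le)
        simp only [Real.exp_log h0] at hi
        have hterm : b (i+1) * r ^ N (i+1) = Real.exp (n i * Real.log r + β i) := by
          rw [hbs, hNs, Real.exp_add, Real.exp_nat_mul, Real.exp_log h0, mul_comm]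
        have h1 : (b (i+1) * r ^ N (i+1))^2 ≤ ∑' j, (b j * r ^ N j)^2 :=
          hS2.le_tsum (i+1) (fun j _ => sq_nonneg _)
        refine le_trans ?_ h1
        have h2 : Real.exp (-C) * w r ≤ b (i+1) * r ^ N (i+1) := by
          rw [hterm, ← Real.exp_log hwr, ← Real.exp_add]
          exact Real.exp_le_exp.2 (by linarith)
        calc _ ≤ Real.exp (-(2*C)) * w r ^ 2 := by
              gcongr
              exact min_le_right _ _
          _ = (Real.exp (-C) * w r)^2 := by
              rw [mul_pow, ← Real.exp_nat_mul]; congr 2; push_cast; ring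
          _ ≤ _ := by gcongr
    · rw [← hS2.sum_add_tsum_nat_add 1]
      simp only [Finset.range_one, Finset.sum_singleton]
      rw [hb0, hN0, pow_zero, mul_one]
      have := key.2.2
      have : w 0 ^ 2 ≤ w r ^ 2 := by gcongr
      linarith

theorem h5_prob {d : ℕ} (hd : 2 ≤ d) : IsProbabilityMeasure (sphereMeasure d) := by
  have : Nonempty (Fin d) := ⟨⟨0, by omega⟩⟩
  constructor
  simp only [sphereMeasure, Measure.smul_apply, smul_eq_mul]
  refine ENNReal.inv_mul_cancel ?_ (measure_ne_top _ _)
  rw [Ne, Measure.measure_univ_eq_zero]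
  exact Measure.toSphere_ne_zero _

theorem h5_openpos {d : ℕ} (U : Set (Metric.sphere (0 : EuclideanSpace ℝ (Fin d)) 1))
    (hU : IsOpen U) (hne : U.Nonempty) : sphereMeasure d U ≠ 0 := by
  simp only [sphereMeasure, Measure.smul_apply, smul_eq_mul]
  refine mul_ne_zero (ENNReal.inv_ne_zero.2 (measure_ne_top _ _)) ?_
  exact hU.measure_ne_zero _ hne

/-- projection to the first two coordinates as a complex number. -/
def h5pi {d : ℕ} (hd : 2 ≤ d) : EuclideanSpace ℝ (Fin d) →L[ℝ] ℂ :=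
  Complex.ofRealCLM.comp (EuclideanSpace.proj (⟨0, by omega⟩ : Fin d)) +
    (Complex.I • Complex.ofRealCLM).comp (EuclideanSpace.proj (⟨1, by omega⟩ : Fin d))

theorem h5pi_apply {d : ℕ} (hd : 2 ≤ d) (x : EuclideanSpace ℝ (Fin d)) :
    h5pi hd x = (x ⟨0, by omega⟩ : ℂ) + Complex.I * (x ⟨1, by omega⟩ : ℂ) := by
  simp [h5pi]

theorem h5pi_norm {d : ℕ} (hd : 2 ≤ d) (x : EuclideanSpace ℝ (Fin d)) :
    ‖h5pi hd x‖ ≤ ‖x‖ := by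
  obtain ⟨e, rfl⟩ : ∃ e, d = e + 2 := ⟨d - 2, by omega⟩
  apply le_of_sq_le_sq _ (norm_nonneg _)
  rw [EuclideanSpace.norm_sq_eq, Fin.sum_univ_succ, Fin.sum_univ_succ, h5pi_apply,
    ← Complex.normSq_eq_norm_sq, Complex.normSq_apply]
  have : 0 ≤ ∑ i : Fin e, ‖x i.succ.succ‖^2 := Finset.sum_nonneg fun i _ => sq_nonneg _
  simp at this ⊢
  have h0 : x ⟨0, by omega⟩ = x 0 := rfl
  have h1 : x ⟨1, by omega⟩ = x 1 := rfl
  nlinarith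

theorem h5_rot {d : ℕ} (hd : 2 ≤ d) (θ : ℝ) :
    ∃ R : EuclideanSpace ℝ (Fin d) ≃ₗᵢ[ℝ] EuclideanSpace ℝ (Fin d),
      ∀ x, h5pi hd (R x) = Complex.exp (θ * Complex.I) * h5pi hd x := by
  obtain ⟨e, rfl⟩ : ∃ e, d = e + 2 := ⟨d - 2, by omega⟩
  let L : EuclideanSpace ℝ (Fin (e+2)) →ₗ[ℝ] EuclideanSpace ℝ (Fin (e+2)) :=
    { toFun := fun x => WithLp.toLp 2 (Fin.cons (Real.cos θ * x 0 - Real.sin θ * x 1)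
        (Fin.cons (Real.sin θ * x 0 + Real.cos θ * x 1) (fun i : Fin e => x i.succ.succ)))
      map_add' := by
        intro x y
        ext i
        refine Fin.cases ?_ (fun i => Fin.cases ?_ (fun i => ?_) i) i <;> simp <;> ring
      map_smul' := by
        intro c x
        ext i
        refine Fin.cases ?_ (fun i => Fin.cases ?_ (fun i => ?_) i) i <;> simp <;> ring }
  have hLn : ∀ x, ‖L x‖ = ‖x‖ := by
    intro x
    rw [← sq_eq_sq₀ (norm_nonneg _) (norm_nonneg _), EuclideanSpace.norm_sq_eq,
      EuclideanSpace.norm_sq_eq, Fin.sum_univ_succ, Fin.sum_univ_succ, Fin.sum_univ_succ,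
      Fin.sum_univ_succ]
    simp [L]
    have := Real.sin_sq_add_cos_sq θ
    linear_combination ((x 0)^2 + (x 1)^2) * this
  let Li : EuclideanSpace ℝ (Fin (e+2)) →ₗᵢ[ℝ] EuclideanSpace ℝ (Fin (e+2)) := ⟨L, hLn⟩
  refine ⟨Li.toLinearIsometryEquiv rfl, fun x => ?_⟩
  rw [LinearIsometry.toLinearIsometryEquiv_apply, h5pi_apply, h5pi_apply, Complex.exp_mul_I]
  have e0 : (Li x) ⟨0, by omega⟩ = Real.cos θ * x 0 - Real.sin θ * x 1 := rfl
  have e1 : (Li x) ⟨1, by omega⟩ = Real.sin θ * x 0 + Real.cos θ * x 1 := rfl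
  have h0 : x ⟨0, by omega⟩ = x 0 := rfl
  have h1 : x ⟨1, by omega⟩ = x 1 := rfl
  rw [e0, e1, h0, h1]
  push_cast
  linear_combination (-Complex.sin θ * (x 1:ℂ)) * Complex.I_sq

open scoped Pointwise in
theorem h5_inv {d : ℕ} (R : EuclideanSpace ℝ (Fin d) ≃ₗᵢ[ℝ] EuclideanSpace ℝ (Fin d))
    (h : EuclideanSpace ℝ (Fin d) → ℂ) (hc : Continuous h) :
    ∫ y : Metric.sphere (0 : EuclideanSpace ℝ (Fin d)) 1, h (R y) ∂(sphereMeasure d) =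
      ∫ y : Metric.sphere (0 : EuclideanSpace ℝ (Fin d)) 1, h y ∂(sphereMeasure d) := by
  let φ : Metric.sphere (0 : EuclideanSpace ℝ (Fin d)) 1 →
    Metric.sphere (0 : EuclideanSpace ℝ (Fin d)) 1 := fun y => ⟨R y, by simp⟩
  have hφ : Continuous φ := by fun_prop
  have hmap : (sphereMeasure d).map φ = sphereMeasure d := by
    rw [sphereMeasure, Measure.map_smul]
    congr 1
    ext s hs
    rw [Measure.map_apply hφ.measurable hs, Measure.toSphere_apply' _ hs,
      Measure.toSphere_apply' _ (hφ.measurable hs)]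
    congr 1
    have : Ioo (0:ℝ) 1 • ((↑) '' (φ ⁻¹' s) : Set (EuclideanSpace ℝ (Fin d))) =
        R ⁻¹' (Ioo (0:ℝ) 1 • ((↑) '' s)) := by
      ext x
      simp only [Set.mem_smul, mem_preimage, mem_image]
      constructor
      · rintro ⟨a, ha, _, ⟨y, hy, rfl⟩, rfl⟩
        exact ⟨a, ha, _, ⟨φ y, hy, rfl⟩, by simp [φ]⟩
      · rintro ⟨a, ha, _, ⟨y, hy, rfl⟩, hx⟩
        refine ⟨a, ha, R.symm y, ⟨⟨R.symm y, by simp⟩, ?_, rfl⟩, ?_⟩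
        · simpa [φ] using hy
        · apply R.injective
          simpa using hx
    rw [this]
    have hmp := R.measurePreserving
    exact hmp.measure_preimage_emb R.toHomeomorph.measurableEmbedding _
  conv_rhs => rw [← hmap]
  exact (integral_map (f := fun y : Metric.sphere (0 : EuclideanSpace ℝ (Fin d)) 1 => h y)
    hφ.measurable.aemeasurable
    (hc.comp continuous_subtype_val).aestronglyMeasurable).symm

theorem h5_vanish {d : ℕ} (hd : 2 ≤ d) (h : ℂ → ℂ) (hc : Continuous h) (m : ℝ) (hm : m ≠ 0)
    (hh : ∀ (θ : ℝ) z, h (Complex.exp (θ * Complex.I) * z) = Complex.exp (θ * m * Complex.I) * h z) :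
    ∫ y : Metric.sphere (0 : EuclideanSpace ℝ (Fin d)) 1, h (h5pi hd y) ∂(sphereMeasure d) = 0 := by
  obtain ⟨R, hR⟩ := h5_rot hd (Real.pi / m)
  have h1 := h5_inv R (fun x => h (h5pi hd x)) (by fun_prop)
  simp only [hR, hh] at h1
  have h2 : Complex.exp (((Real.pi / m : ℝ):ℂ) * m * Complex.I) = -1 := by
    have : ((Real.pi / m : ℝ):ℂ) * m = Real.pi := by
      rw [← Complex.ofReal_mul, div_mul_cancel₀ _ hm]
    rw [this, Complex.exp_pi_mul_I]
  simp only [h2, neg_mul, one_mul, integral_neg] at h1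
  exact self_eq_neg.1 h1.symm

theorem h5_int {d : ℕ} (hd : 2 ≤ d) {G : Type*} [NormedAddCommGroup G] 
    (h : Metric.sphere (0 : EuclideanSpace ℝ (Fin d)) 1 → G) (hc : Continuous h) :
    Integrable h (sphereMeasure d) := by
  have := h5_prob hd
  exact hc.integrable_of_hasCompactSupport (HasCompactSupport.of_compactSpace h)

theorem h5_prodre (z : ℂ) (j k : ℕ) : (z^j).re * (z^k).re =
    (z^j*z^k).re / 2 + (z^j * (starRingEnd ℂ z)^k).re / 2 := by
  rw [← map_pow]
  simp only [Complex.mul_re, Complex.conj_re, Complex.conj_im]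
  ring

theorem h5_split {d : ℕ} (hd : 2 ≤ d) (j k : ℕ) :
    ∫ y : Metric.sphere (0 : EuclideanSpace ℝ (Fin d)) 1,
      ((h5pi hd y)^j).re * ((h5pi hd y)^k).re ∂(sphereMeasure d) =
    (∫ y : Metric.sphere (0 : EuclideanSpace ℝ (Fin d)) 1,
      (h5pi hd y)^j*(h5pi hd y)^k ∂(sphereMeasure d)).re / 2 +
    (∫ y : Metric.sphere (0 : EuclideanSpace ℝ (Fin d)) 1,
      (h5pi hd y)^j*(starRingEnd ℂ (h5pi hd y))^k ∂(sphereMeasure d)).re / 2 := by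
  simp only [h5_prodre]
  have hcj : Continuous (starRingEnd ℂ) := Complex.continuous_conj
  rw [integral_add (h5_int hd _ (by fun_prop)) (h5_int hd _ (by fun_prop)),
    integral_div, integral_div]
  have e1 := Complex.reCLM.integral_comp_comm (h5_int hd (fun y => (h5pi hd y)^j*(h5pi hd y)^k) (by fun_prop))
  have e2 := Complex.reCLM.integral_comp_comm (h5_int hd (fun y => (h5pi hd y)^j*(starRingEnd ℂ (h5pi hd y))^k) (by fun_prop))
  simp only [Complex.reCLM_apply] at e1 e2
  rw [e1, e2]

theorem h5_van1 {d : ℕ} (hd : 2 ≤ d) (j k : ℕ) (h : j + k ≠ 0) :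
    ∫ y : Metric.sphere (0 : EuclideanSpace ℝ (Fin d)) 1,
      (h5pi hd y)^j*(h5pi hd y)^k ∂(sphereMeasure d) = 0 := by
  refine h5_vanish hd (fun z => z^j * z^k) (by fun_prop) ((j + k : ℕ):ℝ) (by exact_mod_cast h) ?_
  intro θ z
  have : Complex.exp (θ * ((j + k : ℕ):ℝ) * Complex.I) = Complex.exp (θ * Complex.I)^(j+k) := by
    rw [← Complex.exp_nat_mul]; congr 1; push_cast; ring
  simp only [this]
  ring

theorem h5_van2 {d : ℕ} (hd : 2 ≤ d) (j k : ℕ) (h : j ≠ k) :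
    ∫ y : Metric.sphere (0 : EuclideanSpace ℝ (Fin d)) 1,
      (h5pi hd y)^j*(starRingEnd ℂ (h5pi hd y))^k ∂(sphereMeasure d) = 0 := by
  have hcj : Continuous (starRingEnd ℂ) := Complex.continuous_conj
  refine h5_vanish hd (fun z => z^j * (starRingEnd ℂ z)^k) (by fun_prop) ((j:ℝ) - k)
    (sub_ne_zero.2 (by exact_mod_cast h)) ?_
  intro θ z
  have : Complex.exp (θ * (((j:ℝ) - k : ℝ):ℂ) * Complex.I) =
      Complex.exp (θ * Complex.I)^j * (starRingEnd ℂ (Complex.exp (θ * Complex.I)))^k := by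
    rw [← Complex.exp_conj, ← Complex.exp_nat_mul, ← Complex.exp_nat_mul, ← Complex.exp_add]
    congr 1
    simp
    ring
  simp only [this, map_mul]
  ring

/-- The norm squared of the k-th harmonic. -/
def h5c {d : ℕ} (hd : 2 ≤ d) (k : ℕ) : ℝ :=
  ∫ y : Metric.sphere (0 : EuclideanSpace ℝ (Fin d)) 1,
      ((h5pi hd y)^k).re * ((h5pi hd y)^k).re ∂(sphereMeasure d)

theorem h5_orth {d : ℕ} (hd : 2 ≤ d) (j k : ℕ) (h : j ≠ k) :
    ∫ y : Metric.sphere (0 : EuclideanSpace ℝ (Fin d)) 1,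
      ((h5pi hd y)^j).re * ((h5pi hd y)^k).re ∂(sphereMeasure d) = 0 := by
  rw [h5_split, h5_van1 hd j k (by omega), h5_van2 hd j k h]
  simp

theorem h5c_lower {d : ℕ} (hd : 2 ≤ d) (s : ℝ) (hs0 : 0 < s) (hs : s < 1) :
    ∃ m > 0, ∀ k, m * s^(2*k) ≤ h5c hd k := by
  have := h5_prob hd
  set U : Set (Metric.sphere (0 : EuclideanSpace ℝ (Fin d)) 1) := {y | s < ‖h5pi hd y‖} with hU
  have hUo : IsOpen U := isOpen_lt continuous_const (by fun_prop)
  have hUn : U.Nonempty := by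
    refine ⟨⟨EuclideanSpace.single ⟨0, by omega⟩ 1, by simp⟩, ?_⟩
    simp [hU, h5pi_apply, hs]
  have hUp : 0 < (sphereMeasure d).real U :=
    ENNReal.toReal_pos (h5_openpos U hUo hUn) (measure_ne_top _ _)
  refine ⟨(sphereMeasure d).real U / 2, by positivity, fun k => ?_⟩
  have h1 : (∫ y : Metric.sphere (0 : EuclideanSpace ℝ (Fin d)) 1,
      (h5pi hd y)^k*(starRingEnd ℂ (h5pi hd y))^k ∂(sphereMeasure d)) =
      ((∫ y : Metric.sphere (0 : EuclideanSpace ℝ (Fin d)) 1,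
      ‖h5pi hd y‖^(2*k) ∂(sphereMeasure d) : ℝ) : ℂ) := by
    rw [← integral_complex_ofReal]
    congr 1
    ext y
    rw [← mul_pow, Complex.mul_conj, pow_mul, Complex.normSq_eq_norm_sq]
    push_cast
    rfl
  have h2 : (sphereMeasure d).real U * s^(2*k) ≤ ∫ y : Metric.sphere (0 : EuclideanSpace ℝ (Fin d)) 1,
      ‖h5pi hd y‖^(2*k) ∂(sphereMeasure d) := by
    have hi := h5_int hd (fun y => ‖h5pi hd y‖^(2*k)) (by fun_prop)
    calc (sphereMeasure d).real U * s^(2*k) = ∫ y in U, s^(2*k) ∂(sphereMeasure d) := by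
          simp
      _ ≤ ∫ y in U, ‖h5pi hd y‖^(2*k) ∂(sphereMeasure d) := by
          refine setIntegral_mono_on (by simp) hi.integrableOn hUo.measurableSet ?_
          intro y hy
          exact pow_le_pow_left₀ hs0.le (le_of_lt hy) _
      _ ≤ _ := setIntegral_le_integral hi (Filter.Eventually.of_forall fun y => by positivity)
  have h3 : 0 ≤ (∫ y : Metric.sphere (0 : EuclideanSpace ℝ (Fin d)) 1,
      (h5pi hd y)^k*(h5pi hd y)^k ∂(sphereMeasure d)).re := by
    by_cases hk : k = 0
    · subst hk; simp
    · rw [h5_van1 hd k k (by omega)]; simp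
  rw [h5c, h5_split, h1, Complex.ofReal_re]
  linarith

theorem h5_harm {d : ℕ} (hd : 2 ≤ d) (F : ℂ → ℂ) (hF : DifferentiableOn ℂ F (Metric.ball 0 1)) :
    IsHarmonicOn (fun x => (F (h5pi hd x)).re) (unitBall d) := by
  have hmaps : MapsTo (h5pi hd) (unitBall d) (Metric.ball 0 1) := by
    intro x hx
    simp only [unitBall, mem_ball_zero_iff] at hx ⊢
    exact (h5pi_norm hd x).trans_lt hx
  have hopen : IsOpen (unitBall d) := Metric.isOpen_ball
  have hgen : ∀ G : ℂ → ℂ, DifferentiableOn ℂ G (Metric.ball 0 1) → ∀ x ∈ unitBall d, ∀ c v,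
      fderiv ℝ (fun y => (G (h5pi hd y) * c).re) x v =
        (deriv G (h5pi hd x) * h5pi hd v * c).re := by
    intro G hG x hx c v
    have h1 : HasDerivAt G (deriv G (h5pi hd x)) (h5pi hd x) :=
      (hG.differentiableAt (Metric.isOpen_ball.mem_nhds (hmaps hx))).hasDerivAt
    have h2 := (h1.mul_const c).hasFDerivAt.restrictScalars ℝ
    have h3 := h2.comp x (h5pi hd).hasFDerivAt
    have h4 := (Complex.reCLM.hasFDerivAt).comp x h3
    have h5 : fderiv ℝ (fun y => (G (h5pi hd y) * c).re) x = _ := h4.fderiv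
    rw [h5]
    simp
    ring
  refine ⟨?_, ?_⟩
  · have h1 : ContDiffOn ℂ 2 F (Metric.ball 0 1) := hF.contDiffOn Metric.isOpen_ball
    have h2 : ContDiffOn ℝ 2 F (Metric.ball 0 1) := h1.restrict_scalars ℝ
    have h3 : ContDiffOn ℝ 2 (F ∘ h5pi hd) (unitBall d) :=
      h2.comp (h5pi hd).contDiff.contDiffOn hmaps
    exact Complex.reCLM.contDiff.comp_contDiffOn h3
  · intro x hx
    have hF' : DifferentiableOn ℂ (deriv F) (Metric.ball 0 1) := hF.deriv Metric.isOpen_ball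
    have key : ∀ v, fderiv ℝ (fun y => fderiv ℝ (fun x => (F (h5pi hd x)).re) y v) x v =
        (deriv (deriv F) (h5pi hd x) * (h5pi hd v * h5pi hd v)).re := by
      intro v
      have he : (fun y => fderiv ℝ (fun x => (F (h5pi hd x)).re) y v) =ᶠ[nhds x]
          (fun y => (deriv F (h5pi hd y) * h5pi hd v).re) := by
        filter_upwards [hopen.mem_nhds hx] with y hy
        have := hgen F hF y hy 1 v
        simpa using this
      rw [he.fderiv_eq, hgen (deriv F) hF' x hx, mul_assoc]
    simp only [key]
    rw [← Complex.re_sum, ← Finset.mul_sum]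
    have : ∑ i : Fin d, h5pi hd (EuclideanSpace.single i 1) * h5pi hd (EuclideanSpace.single i 1) = 0 := by
      obtain ⟨e, rfl⟩ : ∃ e, d = e + 2 := ⟨d - 2, by omega⟩
      rw [Fin.sum_univ_succ, Fin.sum_univ_succ]
      have z0 : (⟨0, by omega⟩ : Fin (e+2)) = 0 := rfl
      have z1 : (⟨1, by omega⟩ : Fin (e+2)) = 1 := rfl
      have hrest : ∀ i : Fin e, h5pi hd (EuclideanSpace.single i.succ.succ 1) = 0 := by
        intro i
        rw [h5pi_apply, z0, z1]
        have a0 : (0 : Fin (e+2)) ≠ i.succ.succ := (Fin.succ_ne_zero _).symm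
        have a1 : (1 : Fin (e+2)) ≠ i.succ.succ := by
          intro h
          have := congrArg Fin.val h
          simp at this
        simp [a0, a1]
      simp only [hrest]
      simp [h5pi_apply]
    rw [this]
    simp

theorem h5_exists {d : ℕ} (hd : 2 ≤ d) (N : ℕ → ℕ) (b : ℕ → ℝ) (hN : Function.Injective N)
    (hb : ∀ j, 0 ≤ b j) (hs : ∀ r ∈ Ico (0:ℝ) 1, Summable (fun j => b j * r ^ N j)) :
    ∃ f : EuclideanSpace ℝ (Fin d) → ℝ, IsHarmonicOn f (unitBall d) ∧
      ∀ r ∈ Ico (0:ℝ) 1, M2sq f r = ∑' j, (b j * r ^ N j)^2 := by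
  have hprob := h5_prob hd
  have hcpos : ∀ k, 0 < h5c hd k := fun k => by
    obtain ⟨m, hm, h⟩ := h5c_lower hd (1/2) (by norm_num) (by norm_num)
    exact lt_of_lt_of_le (by positivity) (h k)
  set a : ℕ → ℝ := fun j => b j / √(h5c hd (N j)) with ha
  have ha0 : ∀ j, 0 ≤ a j := fun j => div_nonneg (hb j) (Real.sqrt_nonneg _)
  have hsa : ∀ r ∈ Ico (0:ℝ) 1, Summable (fun j => a j * r ^ N j) := by
    intro r hr
    obtain ⟨s, hrs, hs1⟩ := exists_between hr.2
    have hs0 : 0 < s := lt_of_le_of_lt hr.1 hrs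
    obtain ⟨m, hm, hlow⟩ := h5c_lower hd s hs0 hs1
    have h1 := (hs (r/s) ⟨div_nonneg hr.1 hs0.le, (div_lt_one hs0).2 hrs⟩).mul_left (1/√m)
    refine Summable.of_nonneg_of_le (fun j => mul_nonneg (ha0 j) (pow_nonneg hr.1 _)) ?_ h1
    intro j
    have h2 : √m * s ^ N j ≤ √(h5c hd (N j)) := by
      apply Real.le_sqrt_of_sq_le
      rw [mul_pow, Real.sq_sqrt hm.le, ← pow_mul, mul_comm (N j)]
      exact hlow _
    have hsm : 0 < √m := Real.sqrt_pos.2 hm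
    have hbj := hb j
    have hr0 := hr.1
    calc a j * r ^ N j ≤ b j / (√m * s ^ N j) * r ^ N j := by
          simp only [ha]; gcongr
      _ = 1/√m * (b j * (r/s)^N j) := by rw [div_pow]; field_simp
  let F : ℂ → ℂ := fun z => ∑' j, (a j : ℂ) * z ^ N j
  have hbd : ∀ r : ℝ, ∀ z : ℂ, ‖z‖ ≤ r → ∀ j, ‖(a j : ℂ) * z ^ N j‖ ≤ a j * r ^ N j := by
    intro r z hz j
    rw [norm_mul, norm_pow, Complex.norm_real, Real.norm_of_nonneg (ha0 j)]
    have := ha0 j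
    gcongr
  have hF : DifferentiableOn ℂ F (Metric.ball 0 1) := by
    intro z hz
    rw [mem_ball_zero_iff] at hz
    obtain ⟨r, hzr, hr1⟩ := exists_between hz
    have hr0 : 0 ≤ r := (norm_nonneg z).trans hzr.le
    have h1 : DifferentiableOn ℂ F (Metric.ball 0 r) :=
      Complex.differentiableOn_tsum_of_summable_norm (hsa r ⟨hr0, hr1⟩)
        (fun j => by fun_prop) Metric.isOpen_ball
        (fun j z hz => hbd r z (by rw [mem_ball_zero_iff] at hz; exact hz.le) j)
    exact (h1.differentiableAt (Metric.isOpen_ball.mem_nhds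
      (by rwa [mem_ball_zero_iff]))).differentiableWithinAt
  refine ⟨_, h5_harm hd F hF, fun r hr => ?_⟩
  have hr0 := hr.1
  set X : ℕ → Metric.sphere (0 : EuclideanSpace ℝ (Fin d)) 1 → ℝ :=
    fun j y => a j * r ^ N j * ((h5pi hd y)^N j).re with hX
  have hXc : ∀ j, Continuous (X j) := fun j => by
    simp only [hX]
    have := Complex.continuous_re
    fun_prop
  have hXb : ∀ j y, ‖X j y‖ ≤ a j * r ^ N j := by
    intro j y
    have h1 : ‖h5pi hd y‖ ≤ 1 := (h5pi_norm hd y).trans (by simp)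
    have h2 : ‖((h5pi hd y)^N j).re‖ ≤ 1 := by
      refine (Complex.abs_re_le_norm _).trans ?_
      rw [norm_pow]
      exact pow_le_one₀ (norm_nonneg _) h1
    have h3 : 0 ≤ a j * r ^ N j := mul_nonneg (ha0 j) (pow_nonneg hr0 _)
    simp only [hX]
    rw [norm_mul, Real.norm_of_nonneg h3]
    nlinarith
  have hXs : ∀ y, Summable (fun j => ‖X j y‖) := fun y =>
    Summable.of_nonneg_of_le (fun j => norm_nonneg _) (fun j => hXb j y) (hsa r hr)
  have hfX : ∀ y : Metric.sphere (0 : EuclideanSpace ℝ (Fin d)) 1,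
      (F (h5pi hd (r • (y : EuclideanSpace ℝ (Fin d))))).re = ∑' j, X j y := by
    intro y
    have hn : ‖h5pi hd (r • (y : EuclideanSpace ℝ (Fin d)))‖ ≤ r := by
      refine (h5pi_norm hd _).trans ?_
      rw [norm_smul, Real.norm_of_nonneg hr0]
      simp
    have hsm : Summable (fun j => (a j : ℂ) * (h5pi hd (r • (y : EuclideanSpace ℝ (Fin d)))) ^ N j) :=
      Summable.of_norm_bounded (hsa r hr) (fun j => hbd r _ hn j)
    simp only [F]
    rw [Complex.re_tsum hsm]
    congr 1
    ext j
    simp only [hX]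
    rw [map_smul, Complex.real_smul, mul_pow, ← Complex.ofReal_pow, ← mul_assoc,
      ← Complex.ofReal_mul, Complex.re_ofReal_mul]
  have hsq : ∀ y, (∑' j, X j y)^2 = ∑' p : ℕ × ℕ, X p.1 y * X p.2 y := by
    intro y
    rw [sq]
    exact tsum_mul_tsum_of_summable_norm (hXs y) (hXs y)
  have hsab : Summable (fun p : ℕ × ℕ => (a p.1 * r ^ N p.1) * (a p.2 * r ^ N p.2)) :=
    (hsa r hr).mul_of_nonneg (hsa r hr)
      (fun j => mul_nonneg (ha0 j) (pow_nonneg hr0 _)) (fun j => mul_nonneg (ha0 j) (pow_nonneg hr0 _))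
  have hpc : ∀ p : ℕ × ℕ, Continuous (fun y => X p.1 y * X p.2 y) := fun p => (hXc _).mul (hXc _)
  have hintg := hasSum_integral_of_summable_integral_norm (μ := sphereMeasure d)
    (F := fun (p : ℕ × ℕ) y => X p.1 y * X p.2 y)
    (fun p => h5_int hd _ (hpc p))
    (by
      refine Summable.of_nonneg_of_le (fun p => integral_nonneg fun y => norm_nonneg _) ?_ hsab
      intro p
      calc ∫ y, ‖X p.1 y * X p.2 y‖ ∂(sphereMeasure d)
          ≤ ∫ y, (a p.1 * r ^ N p.1) * (a p.2 * r ^ N p.2) ∂(sphereMeasure d) := by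
            refine integral_mono (h5_int hd _ (hpc p).norm) (h5_int hd _ continuous_const) ?_
            intro y
            simp only [norm_mul]
            have := hXb p.1 y
            exact mul_le_mul (hXb _ y) (hXb _ y) (norm_nonneg _) ((norm_nonneg _).trans this)
        _ = _ := by simp)
  have hval : ∀ p : ℕ × ℕ, ∫ y, X p.1 y * X p.2 y ∂(sphereMeasure d) =
      (a p.1 * r ^ N p.1) * (a p.2 * r ^ N p.2) * ∫ y : Metric.sphere (0 : EuclideanSpace ℝ (Fin d)) 1,
      ((h5pi hd y)^(N p.1)).re * ((h5pi hd y)^(N p.2)).re ∂(sphereMeasure d) := by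
    intro p
    rw [← integral_const_mul]
    congr 1
    ext y
    simp only [hX]
    ring
  simp only [M2sq, hfX, hsq]
  rw [← hintg.tsum_eq]
  have hinj : Function.Injective (fun j : ℕ => (j, j)) := fun i j h => (Prod.mk.inj h).1
  rw [← hinj.tsum_eq]
  · congr 1
    ext j
    rw [hval]
    change _ * h5c hd (N j) = _
    simp only [ha]
    have h1 := Real.sq_sqrt (hcpos (N j)).le
    have h2 := (Real.sqrt_pos.2 (hcpos (N j))).ne'
    have h3 : ∀ S c : ℝ, S ≠ 0 → S^2 = c →
        b j / S * r ^ N j * (b j / S * r ^ N j) * c = (b j * r ^ N j)^2 := by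
      rintro S c hS rfl
      field_simp
    exact h3 _ _ h2 h1
  · rintro ⟨i, j⟩ hij
    by_contra hne
    have hne' : i ≠ j := fun h => hne ⟨i, by simp [h]⟩
    apply hij
    refine (hval (i, j)).trans ?_
    rw [h5_orth hd _ _ (fun h => hne' (hN h)), mul_zero]

theorem stmt5 {d : ℕ} (hd : 2 ≤ d) (w : ℝ → ℝ) (hw : IsWeight w) (hlc : IsLogConvex w) :
    ∃ f : EuclideanSpace ℝ (Fin d) → ℝ, IsHarmonicOn f (unitBall d) ∧
      ∃ c₁ c₂ : ℝ, 0 < c₁ ∧ 0 < c₂ ∧ ∀ r ∈ Set.Ico (0:ℝ) 1,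
        c₁ * w r ≤ Real.sqrt (M2sq f r) ∧ Real.sqrt (M2sq f r) ≤ c₂ * w r := by
  obtain ⟨N, b, c₁, c₂, hN, hb, hc₁, hc₂, h⟩ := h5_coef w hw hlc
  obtain ⟨f, hf, hM⟩ := h5_exists hd N b hN hb (fun r hr => (h r hr).1)
  refine ⟨f, hf, √c₁, √c₂, Real.sqrt_pos.2 hc₁, Real.sqrt_pos.2 hc₂, fun r hr => ?_⟩
  have hwr := (hw.2.2.1 r hr).le
  obtain ⟨_, h1, h2⟩ := h r hr
  rw [hM r hr]
  constructor
  · have := Real.sqrt_le_sqrt h1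
    rwa [Real.sqrt_mul hc₁.le, Real.sqrt_sq hwr] at this
  · have := Real.sqrt_le_sqrt h2
    rwa [Real.sqrt_mul hc₂.le, Real.sqrt_sq hwr] at this
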